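/- arXiv:2404.17509 — 2 statements merged into one kernel-verified Lean document; each statement's English description precedes it below -/
import Mathlib

section
/- Let α = 1.56. For every correlation clustering instance on a nonempty finite set V, every cluster LP solution z on V, and every triangle T = (u,v,w) on three distinct vertices of V all three of whose pairs uv, uw, vw are +pairs, one has cost(T) ≤ Delta(T), where cost and Delta are defined with parameter α and threshold τ = 0.4. -/
open Finset
open scoped Classical

variable {V : Type*} [Fintype V] [DecidableEq V]

/-- A cluster LP solution on `V`: a nonnegative weight on every nonempty subset of `V`
such that for every vertex `u`, the total weight of sets containing `u` is `1`. -/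
def IsClusterLP (z : Finset V → ℝ) : Prop :=
  (∀ S : Finset V, S.Nonempty → 0 ≤ z S) ∧
  (∀ u : V, ∑ S ∈ univ.filter (fun S : Finset V => u ∈ S), z S = 1)

/-- `y_{uv}`: total weight of sets containing both `u` and `v`. -/
noncomputable def yPair (z : Finset V → ℝ) (u v : V) : ℝ :=
  ∑ S ∈ univ.filter (fun S : Finset V => u ∈ S ∧ v ∈ S), z S

/-- `x_{uv} := 1 - y_{uv}`. -/
noncomputable def xPair (z : Finset V → ℝ) (u v : V) : ℝ :=
  1 - yPair z u v

/-- `y_{uvw}`: total weight of sets containing `u`, `v` and `w`. -/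
noncomputable def yTriple (z : Finset V → ℝ) (u v w : V) : ℝ :=
  ∑ S ∈ univ.filter (fun S : Finset V => u ∈ S ∧ v ∈ S ∧ w ∈ S), z S

/-- `budget^+_α(x) := (α/(1-α/2)) · x²/(1+x)`. -/
noncomputable def budgetPlus (α x : ℝ) : ℝ :=
  (α / (1 - α / 2)) * (x ^ 2 / (1 + x))

/-- `budget^-_α(x) := (α/(1-α/2)) · (1+2x)(1-x)/(2(1+x))`. -/
noncomputable def budgetMinus (α x : ℝ) : ℝ :=
  (α / (1 - α / 2)) * ((1 + 2 * x) * (1 - x) / (2 * (1 + x)))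

/-- `p_u(v)`: probability that `v` joins the cluster of pivot `u`.
It is `1` if `uv` is a short `+`pair (`x_{uv} ≤ 0.4`) and `y_{uv}` otherwise. -/
noncomputable def pPiv (z : Finset V → ℝ) (plus : V → V → Bool) (u v : V) : ℝ :=
  if plus u v = true ∧ xPair z u v ≤ 0.4 then 1 else yPair z u v

/-- `q_u(v,w)`: probability that both `v` and `w` join the cluster of pivot `u`.
It is `y_{uvw}` if `uv` and `uw` are both long `+`pairs, and `p_u(v)·p_u(w)` otherwise. -/
noncomputable def qPiv (z : Finset V → ℝ) (plus : V → V → Bool) (u v w : V) : ℝ :=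
  if (plus u v = true ∧ 0.4 < xPair z u v) ∧ (plus u w = true ∧ 0.4 < xPair z u w) then
    yTriple z u v w
  else pPiv z plus u v * pPiv z plus u w

/-- The budget `b_{vw}` of a pair. -/
noncomputable def bPair (z : Finset V → ℝ) (plus : V → V → Bool) (α : ℝ) (v w : V) : ℝ :=
  if plus v w = true then budgetPlus α (xPair z v w) else budgetMinus α (xPair z v w)

/-- `cost_u(v,w)`. -/
noncomputable def costPiv (z : Finset V → ℝ) (plus : V → V → Bool) (u v w : V) : ℝ :=
  if plus v w = true then pPiv z plus u v + pPiv z plus u w - 2 * qPiv z plus u v w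
  else qPiv z plus u v w

/-- `Delta_u(v,w)`. -/
noncomputable def deltaPiv (z : Finset V → ℝ) (plus : V → V → Bool) (α : ℝ) (u v w : V) : ℝ :=
  (pPiv z plus u v + pPiv z plus u w - qPiv z plus u v w) * bPair z plus α v w

/-- `cost(T)` for a triangle `T = (u,v,w)`. -/
noncomputable def costTri (z : Finset V → ℝ) (plus : V → V → Bool) (u v w : V) : ℝ :=
  costPiv z plus u v w + costPiv z plus v u w + costPiv z plus w u v

/-- `Delta(T)` for a triangle `T = (u,v,w)`. -/
noncomputable def deltaTri (z : Finset V → ℝ) (plus : V → V → Bool) (α : ℝ) (u v w : V) : ℝ :=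
  deltaPiv z plus α u v w + deltaPiv z plus α v u w + deltaPiv z plus α w u v

/-- `cost_u(u,v)` for a degenerate triangle. -/
noncomputable def costDegPiv (z : Finset V → ℝ) (plus : V → V → Bool) (u v : V) : ℝ :=
  if plus u v = true then 1 - pPiv z plus u v else pPiv z plus u v

/-- `cost(T)` for a degenerate triangle `T = (u,v)`. -/
noncomputable def costDeg (z : Finset V → ℝ) (plus : V → V → Bool) (u v : V) : ℝ :=
  costDegPiv z plus u v + costDegPiv z plus v u

/-- `Delta(T)` for a degenerate triangle `T = (u,v)`. -/
noncomputable def deltaDeg (z : Finset V → ℝ) (plus : V → V → Bool) (α : ℝ) (u v : V) : ℝ :=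
  2 * bPair z plus α u v

theorem yPair_comm (z : Finset V → ℝ) (u v : V) : yPair z u v = yPair z v u := by
  simp only [yPair, and_comm]

theorem yTriple_swap_right (z : Finset V → ℝ) (u v w : V) :
    yTriple z u v w = yTriple z u w v := by
  simp only [yTriple, and_comm]

theorem yTriple_swap_left (z : Finset V → ℝ) (u v w : V) :
    yTriple z u v w = yTriple z v u w := by
  simp only [yTriple, and_left_comm]

theorem yTriple_nonneg {z : Finset V → ℝ} (hz : IsClusterLP z) (u v w : V) :
    0 ≤ yTriple z u v w :=
  Finset.sum_nonneg fun S hS => hz.1 S ⟨u, (Finset.mem_filter.1 hS).2.1⟩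

theorem yTriple_le_yPair {z : Finset V → ℝ} (hz : IsClusterLP z) (u v w : V) :
    yTriple z u v w ≤ yPair z u v := by
  refine Finset.sum_le_sum_of_subset_of_nonneg ?_ ?_
  · intro S hS
    simp only [Finset.mem_filter] at hS ⊢
    tauto
  · intro S hS _
    exact hz.1 S ⟨u, (Finset.mem_filter.1 hS).2.1⟩

theorem yPair_add_yPair_le {z : Finset V → ℝ} (hz : IsClusterLP z) (u v w : V) :
    yPair z u v + yPair z u w ≤ 1 + yTriple z u v w := by
  rw [← hz.2 u]
  simp only [yPair, yTriple, Finset.sum_filter]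
  rw [← Finset.sum_add_distrib, ← Finset.sum_add_distrib]
  refine Finset.sum_le_sum fun S _ => ?_
  by_cases hu : u ∈ S
  · have := hz.1 S ⟨u, hu⟩
    by_cases hv : v ∈ S <;> by_cases hw : w ∈ S <;> simp [hu, hv, hw, this]
  · simp [hu]

theorem budgetPlus_nonneg {x : ℝ} (hx : 0 ≤ x) : 0 ≤ budgetPlus 1.56 x := by
  unfold budgetPlus
  have : (0 : ℝ) ≤ 1.56 / (1 - 1.56 / 2) := by norm_num
  positivity

theorem linear_le_budgetPlus {x : ℝ} (hx : 0 ≤ x) :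
    3.4 * x - 0.56 ≤ budgetPlus 1.56 x := by
  unfold budgetPlus
  rw [← mul_div_assoc, le_div_iff₀ (by linarith)]
  norm_num
  nlinarith [sq_nonneg (x - 0.385)]

/-- The inequality for three long pairs, with the budgets replaced by the lower bounds of
`linear_le_budgetPlus`, affine in the pair distances `x`, `y`, `s`. -/
theorem cost_le_delta_of_long {x y s t : ℝ} (hx : 0.4 ≤ x) (hy : 0.4 ≤ y) (hs : 0.4 ≤ s)
    (ht : 0 ≤ t) (htx : t ≤ 1 - x) (hty : t ≤ 1 - y) (hts : t ≤ 1 - s)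
    (hxy : 1 - x - y ≤ t) (hxs : 1 - x - s ≤ t) (hys : 1 - y - s ≤ t) :
    6 - 2 * (x + y + s) - 6 * t ≤
      (2 - x - y - t) * (3.4 * s - 0.56) + (2 - x - s - t) * (3.4 * y - 0.56) +
        (2 - y - s - t) * (3.4 * x - 0.56) := by
  nlinarith [mul_nonneg (sub_nonneg.2 htx) (sub_nonneg.2 hys), mul_nonneg (sub_nonneg.2 hty) (sub_nonneg.2 hxs),
    mul_nonneg (sub_nonneg.2 hts) (sub_nonneg.2 hxy), mul_nonneg ht (sub_nonneg.2 hx),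
    mul_nonneg ht (sub_nonneg.2 hy), mul_nonneg ht (sub_nonneg.2 hs),
    mul_nonneg (sub_nonneg.2 htx) (sub_nonneg.2 hy), mul_nonneg (sub_nonneg.2 htx) (sub_nonneg.2 hs),
    mul_nonneg (sub_nonneg.2 hty) (sub_nonneg.2 hx), mul_nonneg (sub_nonneg.2 hty) (sub_nonneg.2 hs),
    mul_nonneg (sub_nonneg.2 hts) (sub_nonneg.2 hx), mul_nonneg (sub_nonneg.2 hts) (sub_nonneg.2 hy)]

theorem ppp_triangle_cost_le_budget [Nonempty V]
    (α : ℝ) (hα : α = 1.56)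
    (plus : V → V → Bool) (hsym : ∀ a b : V, plus a b = plus b a)
    (z : Finset V → ℝ) (hz : IsClusterLP z)
    (u v w : V) (huv : u ≠ v) (huw : u ≠ w) (hvw : v ≠ w)
    (hpuv : plus u v = true) (hpuw : plus u w = true) (hpvw : plus v w = true) :
    costTri z plus u v w ≤ deltaTri z plus α u v w := by
  subst hα
  have hxuv := yPair_comm z v u
  have hxuw := yPair_comm z w u
  have hxvw := yPair_comm z w v
  have htv : yTriple z v u w = yTriple z u v w := yTriple_swap_left z v u w
  have htw : yTriple z w u v = yTriple z u v w := by
    rw [yTriple_swap_left, yTriple_swap_right]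
  have h0 := yTriple_nonneg hz u v w
  have hle_uv := yTriple_le_yPair hz u v w
  have hle_uw := yTriple_le_yPair hz u w v
  rw [yTriple_swap_right] at hle_uw
  have hle_vw := yTriple_le_yPair hz v w u
  rw [yTriple_swap_right, htv] at hle_vw
  have hu := yPair_add_yPair_le hz u v w
  have hv := yPair_add_yPair_le hz v u w
  have hw := yPair_add_yPair_le hz w u v
  rw [htv, hxuv] at hv
  rw [htw, hxuw, hxvw] at hw
  simp only [costTri, deltaTri, costPiv, deltaPiv, qPiv, pPiv, bPair, hsym v u, hsym w u, hsym w v,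
    hpuv, hpuw, hpvw, xPair, hxuv, hxuw, hxvw, htv, htw, true_and, if_true]
  generalize yTriple z u v w = t at *
  obtain ⟨x, hx⟩ : ∃ x, yPair z u v = 1 - x := ⟨1 - yPair z u v, by ring⟩
  obtain ⟨y, hy⟩ : ∃ y, yPair z u w = 1 - y := ⟨1 - yPair z u w, by ring⟩
  obtain ⟨s, hs⟩ : ∃ s, yPair z v w = 1 - s := ⟨1 - yPair z v w, by ring⟩
  simp only [hx, hy, hs, sub_sub_cancel] at hle_uv hle_uw hle_vw hu hv hw ⊢
  have hx0 : 0 ≤ x := by linarith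
  have hy0 : 0 ≤ y := by linarith
  have hs0 : 0 ≤ s := by linarith
  have bx0 := budgetPlus_nonneg hx0
  have by0 := budgetPlus_nonneg hy0
  have bs0 := budgetPlus_nonneg hs0
  have bx := linear_le_budgetPlus hx0
  have hby := linear_le_budgetPlus hy0
  have bs := linear_le_budgetPlus hs0
  generalize budgetPlus 1.56 x = a at *
  generalize budgetPlus 1.56 y = b at *
  generalize budgetPlus 1.56 s = c at *
  have wx : 0 ≤ (2 - y - s - t) * a := mul_nonneg (by linarith) bx0
  have wy : 0 ≤ (2 - x - s - t) * b := mul_nonneg (by linarith) by0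
  have ws : 0 ≤ (2 - x - y - t) * c := mul_nonneg (by linarith) bs0
  rcases le_or_gt x 0.4 with hx4 | hx4 <;> rcases le_or_gt y 0.4 with hy4 | hy4 <;>
    rcases le_or_gt s 0.4 with hs4 | hs4 <;>
    simp only [hx4, hy4, hs4, not_lt_of_ge, not_le_of_gt, and_true, and_false, if_true, if_false]
  case inr.inr.inr =>
    have := cost_le_delta_of_long hx4.le hy4.le hs4.le h0 hle_uv hle_uw hle_vw
      (by linarith) (by linarith) (by linarith)
    have lx := mul_le_mul_of_nonneg_left bx (by linarith : 0 ≤ 2 - y - s - t)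
    have ly := mul_le_mul_of_nonneg_left hby (by linarith : 0 ≤ 2 - x - s - t)
    have ls := mul_le_mul_of_nonneg_left bs (by linarith : 0 ≤ 2 - x - y - t)
    linarith
  all_goals linarith
end

section
/- In the averaged preclustered setting, let ε ∈ (0,1). Then for every u ∈ V one has d^2_u − k_u ≤ (1/ε² + 1/ε)·(w_u − k_u). -/
open Finset
open scoped Classical

variable {V : Type*} [Fintype V] [DecidableEq V]

/-- The weight `w_{uv}`: the fraction of pairs between the atoms of `u` and `v`
that are `+`pairs (with `u' = v'` counted as a `+`pair). -/
noncomputable def wgt (plus : V → V → Bool) (Katom : V → Finset V) (u v : V) : ℝ :=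
  (((Katom u ×ˢ Katom v).filter (fun p => p.1 = p.2 ∨ plus p.1 p.2 = true)).card : ℝ) /
    (((Katom u).card : ℝ) * ((Katom v).card : ℝ))

/-- `w(u, A) := ∑_{v ∈ A} w_{uv}`. -/
noncomputable def wSet (plus : V → V → Bool) (Katom : V → Finset V) (u : V) (A : Finset V) : ℝ :=
  ∑ v ∈ A, wgt plus Katom u v

/-- `w_u := w(u, V)`. -/
noncomputable def wTot (plus : V → V → Bool) (Katom : V → Finset V) (u : V) : ℝ :=
  wSet plus Katom u univ

/-- `N^1_u`: the neighbors of `u` in `E^1`, i.e. vertices `v` with `ε·w_v < w_u < w_v/ε`. -/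
noncomputable def N1 (plus : V → V → Bool) (Katom : V → Finset V) (ε : ℝ) (u : V) : Finset V :=
  univ.filter (fun v =>
    ε * wTot plus Katom v < wTot plus Katom u ∧ wTot plus Katom u < wTot plus Katom v / ε)

/-- `N^2_u`: the neighbors of `u` in `E^2`, i.e. vertices `v` in the same atom as `u`, or
with `uv ∈ E^1` and total weight of common `E^1`-neighborhood exceeding `ε(w_u + w_v)`. -/
noncomputable def N2 (plus : V → V → Bool) (Katom : V → Finset V) (ε : ℝ) (u : V) : Finset V :=
  univ.filter (fun v =>
    Katom u = Katom v ∨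
      (v ∈ N1 plus Katom ε u ∧
        ε * (wTot plus Katom u + wTot plus Katom v) <
          ∑ p ∈ N1 plus Katom ε u ∩ N1 plus Katom ε v,
            wgt plus Katom u p * wgt plus Katom v p))

omit [Fintype V] in
theorem wgt_nonneg (plus : V → V → Bool) (Katom : V → Finset V) (u v : V) :
    0 ≤ wgt plus Katom u v := by
  unfold wgt
  positivity

omit [Fintype V] in
theorem wgt_comm (plus : V → V → Bool) (hsym : ∀ a b : V, plus a b = plus b a)
    (Katom : V → Finset V) (u v : V) : wgt plus Katom u v = wgt plus Katom v u := by
  unfold wgt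
  rw [mul_comm ((Katom u).card : ℝ)]
  congr 2
  refine Finset.card_bij' (fun p _ => p.swap) (fun p _ => p.swap) ?_ ?_ ?_ ?_
  · rintro ⟨a, b⟩ h
    simp only [mem_filter, mem_product, Prod.swap] at h ⊢
    exact ⟨h.1.symm, h.2.imp Eq.symm fun h => (hsym b a).trans h⟩
  · rintro ⟨a, b⟩ h
    simp only [mem_filter, mem_product, Prod.swap] at h ⊢
    exact ⟨h.1.symm, h.2.imp Eq.symm fun h => (hsym b a).trans h⟩
  · simp
  · simp

omit [Fintype V] in
theorem wgt_congr_right (plus : V → V → Bool) (Katom : V → Finset V) (u : V) {v v' : V}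
    (h : Katom v = Katom v') : wgt plus Katom u v = wgt plus Katom u v' := by
  simp only [wgt, h]

omit [Fintype V] in
theorem wgt_eq_one (plus : V → V → Bool) (Katom : V → Finset V)
    (hmem : ∀ u : V, u ∈ Katom u)
    (hpart : ∀ u v : V, v ∈ Katom u → Katom v = Katom u)
    (hatomplus : ∀ u v : V, v ∈ Katom u → u ≠ v → plus u v = true)
    {u v : V} (hv : v ∈ Katom u) : wgt plus Katom u v = 1 := by
  unfold wgt
  rw [hpart u v hv, Finset.filter_true_of_mem, card_product, Nat.cast_mul]
  · have : ((Katom u).card : ℝ) ≠ 0 := by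
      exact_mod_cast (Finset.card_pos.2 ⟨u, hmem u⟩).ne'
    field_simp
  · rintro ⟨a, b⟩ h
    rw [mem_product] at h
    by_cases hab : a = b
    · exact Or.inl hab
    · exact Or.inr (hatomplus a b (by rw [hpart u a h.1]; exact h.2) hab)

theorem sum_wgt_le_wTot (plus : V → V → Bool) (Katom : V → Finset V) (u : V) (A : Finset V) :
    ∑ v ∈ A, wgt plus Katom u v ≤ wTot plus Katom u :=
  Finset.sum_le_sum_of_subset_of_nonneg (subset_univ A) fun _ _ _ => wgt_nonneg ..

theorem wTot_eq_card_add (plus : V → V → Bool) (Katom : V → Finset V)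
    (hmem : ∀ u : V, u ∈ Katom u)
    (hpart : ∀ u v : V, v ∈ Katom u → Katom v = Katom u)
    (hatomplus : ∀ u v : V, v ∈ Katom u → u ≠ v → plus u v = true) (u : V) :
    wTot plus Katom u =
      ((Katom u).card : ℝ) + ∑ p with p ∉ Katom u, wgt plus Katom u p := by
  unfold wTot wSet
  rw [← Finset.sum_filter_add_sum_filter_not univ (fun p => p ∈ Katom u)]
  congr 1
  rw [Finset.sum_congr rfl (g := fun _ => (1 : ℝ))]
  · simp
  · intro p hp
    exact wgt_eq_one plus Katom hmem hpart hatomplus (mem_filter.1 hp).2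

theorem sum_common_le (plus : V → V → Bool) (hsym : ∀ a b : V, plus a b = plus b a)
    (Katom : V → Finset V)
    (hmem : ∀ u : V, u ∈ Katom u)
    (hpart : ∀ u v : V, v ∈ Katom u → Katom v = Katom u)
    (hatomplus : ∀ u v : V, v ∈ Katom u → u ≠ v → plus u v = true) (ε : ℝ) (u v : V) :
    ∑ p ∈ N1 plus Katom ε u ∩ N1 plus Katom ε v, wgt plus Katom u p * wgt plus Katom v p ≤
      ((Katom u).card : ℝ) * wgt plus Katom u v +
        ∑ p ∈ N1 plus Katom ε u with p ∉ Katom u, wgt plus Katom u p * wgt plus Katom p v := by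
  have hnn : ∀ p, 0 ≤ wgt plus Katom u p * wgt plus Katom v p := fun p =>
    mul_nonneg (wgt_nonneg ..) (wgt_nonneg ..)
  refine (Finset.sum_le_sum_of_subset_of_nonneg inter_subset_left fun p _ _ => hnn p).trans ?_
  rw [← Finset.sum_filter_add_sum_filter_not (N1 plus Katom ε u) (fun p => p ∈ Katom u)]
  refine add_le_add ?_ (le_of_eq ?_)
  · calc ∑ p ∈ N1 plus Katom ε u with p ∈ Katom u, wgt plus Katom u p * wgt plus Katom v p
        ≤ ∑ p ∈ Katom u, wgt plus Katom u p * wgt plus Katom v p :=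
          Finset.sum_le_sum_of_subset_of_nonneg (fun p hp => (mem_filter.1 hp).2)
            fun p _ _ => hnn p
      _ = ∑ _p ∈ Katom u, wgt plus Katom u v := by
          refine Finset.sum_congr rfl fun p hp => ?_
          rw [wgt_eq_one plus Katom hmem hpart hatomplus hp, one_mul,
            wgt_congr_right plus Katom v (hpart u p hp), wgt_comm plus hsym]
      _ = _ := by simp
  · exact Finset.sum_congr rfl fun p _ => by rw [wgt_comm plus hsym Katom v p]

theorem d2_degree_bound
    (plus : V → V → Bool) (hsym : ∀ a b : V, plus a b = plus b a)
    (Katom : V → Finset V)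
    (hmem : ∀ u : V, u ∈ Katom u)
    (hpart : ∀ u v : V, v ∈ Katom u → Katom v = Katom u)
    (hatomplus : ∀ u v : V, v ∈ Katom u → u ≠ v → plus u v = true)
    (ε : ℝ) (hε : ε ∈ Set.Ioo (0 : ℝ) 1) :
    ∀ u : V,
      ((N2 plus Katom ε u).card : ℝ) - ((Katom u).card : ℝ) ≤
        (1 / ε ^ 2 + 1 / ε) * (wTot plus Katom u - ((Katom u).card : ℝ)) := by
  intro u
  obtain ⟨hε0, -⟩ := hε
  set k : ℝ := ((Katom u).card : ℝ) with hk
  set W := wTot plus Katom u with hW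
  set D := ∑ p with p ∉ Katom u, wgt plus Katom u p with hD
  have hWD : W = k + D := wTot_eq_card_add plus Katom hmem hpart hatomplus u
  have hk0 : 0 < k := by
    rw [hk]
    exact_mod_cast Finset.card_pos.2 ⟨u, hmem u⟩
  have hD0 : 0 ≤ D := Finset.sum_nonneg fun _ _ => wgt_nonneg ..
  have hW0 : 0 < W := by linarith
  have hwT0 : ∀ v, 0 ≤ wTot plus Katom v := fun v => Finset.sum_nonneg fun _ _ => wgt_nonneg ..
  set S := (N2 plus Katom ε u).filter (fun v => v ∉ Katom u) with hS
  have hcard : ((N2 plus Katom ε u).card : ℝ) ≤ k + S.card := by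
    rw [← Finset.card_filter_add_card_filter_not (s := N2 plus Katom ε u) (fun v => v ∈ Katom u),
      Nat.cast_add]
    refine add_le_add (Nat.cast_le.2 (Finset.card_le_card ?_)) le_rfl
    exact fun v hv => (Finset.mem_filter.1 hv).2
  have hpt : ∀ v ∈ S, ε * W ≤ k * wgt plus Katom u v +
      ∑ p ∈ N1 plus Katom ε u with p ∉ Katom u, wgt plus Katom u p * wgt plus Katom p v := by
    intro v hv
    obtain ⟨hv2, hvK⟩ := mem_filter.1 hv
    refine le_trans ?_ (sum_common_le plus hsym Katom hmem hpart hatomplus ε u v)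
    rcases (mem_filter.1 hv2).2 with h | ⟨-, h⟩
    · exact absurd (h ▸ hmem v) hvK
    · refine le_trans ?_ h.le
      gcongr
      exact le_add_of_nonneg_right (hwT0 v)
  have hfirst : ∑ v ∈ S, wgt plus Katom u v ≤ D :=
    Finset.sum_le_sum_of_subset_of_nonneg
      (fun v hv => mem_filter.2 ⟨mem_univ v, (mem_filter.1 hv).2⟩) fun _ _ _ => wgt_nonneg ..
  have hsecond : ∑ v ∈ S, ∑ p ∈ N1 plus Katom ε u with p ∉ Katom u,
      wgt plus Katom u p * wgt plus Katom p v ≤ D * (W / ε) := by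
    rw [Finset.sum_comm]
    simp only [← Finset.mul_sum]
    calc _ ≤ ∑ p ∈ N1 plus Katom ε u with p ∉ Katom u, wgt plus Katom u p * (W / ε) := by
          refine Finset.sum_le_sum fun p hp => ?_
          have hp1 := (mem_filter.1 (mem_filter.1 hp).1).2.1
          refine mul_le_mul_of_nonneg_left ((sum_wgt_le_wTot plus Katom p S).trans ?_)
            (wgt_nonneg ..)
          rw [le_div_iff₀ hε0, mul_comm]
          exact hp1.le
      _ = (∑ p ∈ N1 plus Katom ε u with p ∉ Katom u, wgt plus Katom u p) * (W / ε) := by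
          rw [Finset.sum_mul]
      _ ≤ D * (W / ε) := by
          refine mul_le_mul_of_nonneg_right ?_ (by positivity)
          exact Finset.sum_le_sum_of_subset_of_nonneg
            (fun p hp => mem_filter.2 ⟨mem_univ p, (mem_filter.1 hp).2⟩) fun _ _ _ => wgt_nonneg ..
  have hsum := Finset.sum_le_sum hpt
  rw [Finset.sum_const, nsmul_eq_mul, Finset.sum_add_distrib, ← Finset.mul_sum] at hsum
  have hkey : (S.card : ℝ) * (ε * W) ≤ ((1 / ε ^ 2 + 1 / ε) * D) * (ε * W) :=
    calc (S.card : ℝ) * (ε * W) ≤ W * D + D * (W / ε) := by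
          refine hsum.trans (add_le_add ?_ hsecond)
          exact mul_le_mul (by linarith) hfirst (Finset.sum_nonneg fun _ _ => wgt_nonneg ..) hW0.le
      _ = ((1 / ε ^ 2 + 1 / ε) * D) * (ε * W) := by
          field_simp
          ring
  have hSD := le_of_mul_le_mul_right hkey (by positivity)
  rw [show W - k = D by linarith]
  linarith
end
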